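/- Let α ≥ 1, let 0 < ε < 1, and let ρ > 0 satisfy α·ln(1 − exp(−ρ²/2)) > −ε²/4. Let u₁, …, u_m ∈ ℝⁿ with ‖uᵢ‖ ≤ 1 for all i and m ≤ αn, and let Q = {y ∈ ℝⁿ : |⟨y, uᵢ⟩| ≤ ρ for i = 1, …, m}. Then for all sufficiently large n, the standard Gaussian measure of the set {y ∈ ℝⁿ : y ∈ Q and ‖y‖² ≥ (1 − ε)n} is at least (1/2)·(1 − exp(−ρ²/2))^(αn). -/

import Mathlib

open MeasureTheory
open scoped RealInnerProductSpace

/-- The standard Gaussian probability measure on `ℝⁿ`, with density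
`(2π)^{-n/2} e^{-‖x‖²/2}` with respect to Lebesgue measure. -/
noncomputable def stdGaussian (n : ℕ) : Measure (EuclideanSpace ℝ (Fin n)) :=
  volume.withDensity fun x =>
    ENNReal.ofReal ((2 * Real.pi) ^ (-(n : ℝ) / 2) * Real.exp (-‖x‖ ^ 2 / 2))

open ProbabilityTheory hiding stdGaussian

/-- The one-dimensional Brunn–Minkowski inequality for compact sets. -/
theorem volume_add_volume_le_of_isCompact {A B C : Set ℝ} (hA : IsCompact A) (hB : IsCompact B)
    (hA0 : A.Nonempty) (hB0 : B.Nonempty) (h : ∀ x ∈ A, ∀ y ∈ B, x + y ∈ C) :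
    volume A + volume B ≤ volume C := by
  obtain ⟨s, hsA, hs⟩ := hA.exists_isGreatest hA0
  obtain ⟨t, htB, ht⟩ := hB.exists_isLeast hB0
  rw [← measure_inter_add_sdiff C (measurableSet_Iic (a := s + t))]
  refine add_le_add ?_ ?_
  · rw [← measure_preimage_add_right volume (-t) A]
    refine measure_mono fun x hx => ?_
    have hx' : x + -t ∈ A := hx
    refine ⟨by simpa using h _ hx' t htB, ?_⟩
    have := hs hx'
    simp only [Set.mem_Iic]
    linarith
  · have hnull : volume B = volume (B \ {t}) := (measure_sdiff_null (measure_singleton t)).symm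
    rw [hnull, ← measure_preimage_add_right volume (-s) (B \ {t})]
    refine measure_mono fun x hx => ?_
    have hx1 : x + -s ∈ B := hx.1
    have hx2 : x + -s ≠ t := hx.2
    refine ⟨by simpa using h s hsA _ hx1, ?_⟩
    have := lt_of_le_of_ne (ht hx1) hx2.symm
    simp only [Set.mem_Iic, not_le]
    linarith

/-- The one-dimensional Brunn–Minkowski inequality. -/
theorem volume_add_volume_le {A B C : Set ℝ} (hA : MeasurableSet A) (hB : MeasurableSet B)
    (hA0 : A.Nonempty) (hB0 : B.Nonempty) (h : ∀ x ∈ A, ∀ y ∈ B, x + y ∈ C) :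
    volume A + volume B ≤ volume C := by
  obtain ⟨p, hp⟩ := hA0
  obtain ⟨q, hq⟩ := hB0
  rw [hA.measure_eq_iSup_isCompact, hB.measure_eq_iSup_isCompact]
  simp only [iSup_and']
  refine ENNReal.biSup_add_biSup_le' ⟨∅, by simp⟩ ⟨∅, by simp⟩ ?_
  intro K hK L hL
  refine (add_le_add (measure_mono (Set.subset_insert p K))
    (measure_mono (Set.subset_insert q L))).trans ?_
  refine volume_add_volume_le_of_isCompact (hK.2.insert p) (hL.2.insert q)
    (Set.insert_nonempty _ _) (Set.insert_nonempty _ _) fun x hx y hy => h x ?_ y ?_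
  · exact Set.insert_subset hp hK.1 hx
  · exact Set.insert_subset hq hL.1 hy

open scoped Pointwise in
theorem ofReal_mul_volume_add_le {A B C : Set ℝ} {a b : ℝ} (ha : 0 < a) (hb : 0 < b)
    (hA : MeasurableSet A) (hB : MeasurableSet B) (hA0 : A.Nonempty) (hB0 : B.Nonempty)
    (h : ∀ x ∈ A, ∀ y ∈ B, a * x + b * y ∈ C) :
    ENNReal.ofReal a * volume A + ENNReal.ofReal b * volume B ≤ volume C := by
  have key := volume_add_volume_le (C := C) (hA.const_smul₀ a) (hB.const_smul₀ b) (hA0.smul_set)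
    (hB0.smul_set) (by
      rintro _ ⟨x, hx, rfl⟩ _ ⟨y, hy, rfl⟩
      exact h x hx y hy)
  simpa [Measure.addHaar_smul, abs_of_pos ha, abs_of_pos hb] using key

/-- The one-dimensional Prékopa–Leindler inequality for functions with supremum `1`, in its
stronger additive form. -/
theorem add_lintegral_le_of_sup_eq_one {f g h : ℝ → ℝ} {a b : ℝ} (ha : 0 < a) (hb : 0 < b)
    (hab : a + b = 1) (hf : Measurable f) (hg : Measurable g) (hh : Measurable h)
    (hf0 : ∀ x, 0 ≤ f x) (hg0 : ∀ x, 0 ≤ g x) (hh0 : ∀ x, 0 ≤ h x)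
    (hf1 : ∀ x, f x ≤ 1) (hg1 : ∀ x, g x ≤ 1)
    (hfs : ∀ t < 1, ∃ x, t < f x) (hgs : ∀ t < 1, ∃ x, t < g x)
    (H : ∀ x y, f x ^ a * g y ^ b ≤ h (a * x + b * y)) :
    ENNReal.ofReal a * (∫⁻ x, ENNReal.ofReal (f x)) +
      ENNReal.ofReal b * (∫⁻ x, ENNReal.ofReal (g x)) ≤ ∫⁻ x, ENNReal.ofReal (h x) := by
  have cut : ∀ F : ℝ → ℝ, Measurable F → (∀ x, 0 ≤ F x) → (∀ x, F x ≤ 1) →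
      ∫⁻ x, ENNReal.ofReal (F x) = ∫⁻ t in Set.Ioo 0 1, volume {x | t < F x} := by
    intro F hF hF0 hF1
    rw [lintegral_eq_lintegral_meas_lt volume (ae_of_all _ hF0) hF.aemeasurable]
    rw [← Set.Ioo_union_Ici_eq_Ioi (zero_lt_one' ℝ), lintegral_union measurableSet_Ici]
    · have : ∫⁻ t in Set.Ici (1 : ℝ), volume {x | t < F x} = 0 := by
        rw [setLIntegral_congr_fun (g := fun _ => 0) measurableSet_Ici]
        · simp
        · intro t ht
          have : {x | t < F x} = ∅ := by
            ext x
            simpa using (hF1 x).trans ht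
          simp [this]
      rw [this, add_zero]
    · exact Set.disjoint_left.2 fun x hx hx' => absurd hx.2 (not_lt.2 hx')
  have meas : ∀ F : ℝ → ℝ, Measurable fun t => volume {x | t < F x} := fun F =>
    Antitone.measurable fun s t hst => measure_mono fun x (hx : t < F x) => hst.trans_lt hx
  rw [cut f hf hf0 hf1, cut g hg hg0 hg1, ← lintegral_const_mul _ (meas f),
    ← lintegral_const_mul _ (meas g), ← lintegral_add_left ((meas f).const_mul _),
    lintegral_eq_lintegral_meas_lt volume (ae_of_all _ hh0) hh.aemeasurable]
  refine le_trans ?_ (lintegral_mono_set (s := Set.Ioo 0 1) Set.Ioo_subset_Ioi_self)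
  refine setLIntegral_mono' measurableSet_Ioo fun t ht => ?_
  refine ofReal_mul_volume_add_le ha hb (measurableSet_lt measurable_const hf)
    (measurableSet_lt measurable_const hg) (hfs t ht.2) (hgs t ht.2) fun x hx y hy => ?_
  have hx' : t < f x := hx
  have hy' : t < g y := hy
  refine lt_of_lt_of_le ?_ (H x y)
  calc t = t ^ a * t ^ b := by rw [← Real.rpow_add ht.1, hab, Real.rpow_one]
    _ < f x ^ a * g y ^ b := by
      have := Real.rpow_lt_rpow ht.1.le hx' ha
      have := Real.rpow_lt_rpow ht.1.le hy' hb
      have := Real.rpow_pos_of_pos ht.1 a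
      have := Real.rpow_pos_of_pos ht.1 b
      gcongr

/-- The one-dimensional Prékopa–Leindler inequality for bounded integrable functions. -/
theorem integral_rpow_mul_integral_rpow_le {f g h : ℝ → ℝ} {a b M : ℝ} (ha : 0 < a) (hb : 0 < b)
    (hab : a + b = 1) (hf : Measurable f) (hg : Measurable g) (hh : Measurable h)
    (hfi : Integrable f) (hgi : Integrable g) (hhi : Integrable h)
    (hf0 : ∀ x, 0 ≤ f x) (hg0 : ∀ x, 0 ≤ g x) (hh0 : ∀ x, 0 ≤ h x)
    (hfM : ∀ x, f x ≤ M) (hgM : ∀ x, g x ≤ M)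
    (H : ∀ x y, f x ^ a * g y ^ b ≤ h (a * x + b * y)) :
    (∫ x, f x) ^ a * (∫ x, g x) ^ b ≤ ∫ x, h x := by
  have hh_int : 0 ≤ ∫ x, h x := integral_nonneg hh0
  have hfb : BddAbove (Set.range f) := ⟨M, by rintro _ ⟨x, rfl⟩; exact hfM x⟩
  have hgb : BddAbove (Set.range g) := ⟨M, by rintro _ ⟨x, rfl⟩; exact hgM x⟩
  have zero_of : ∀ F : ℝ → ℝ, (∀ x, 0 ≤ F x) → BddAbove (Set.range F) → ¬ 0 < (⨆ x, F x) →
      ∫ x, F x = 0 := by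
    intro F hF0 hFb hF
    have : ∀ x, F x = 0 := fun x => le_antisymm ((le_ciSup hFb x).trans (not_lt.1 hF)) (hF0 x)
    simp [this]
  by_cases hp : 0 < ⨆ x, f x
  swap
  · rw [zero_of f hf0 hfb hp, Real.zero_rpow ha.ne', zero_mul]; exact hh_int
  by_cases hq : 0 < ⨆ x, g x
  swap
  · rw [zero_of g hg0 hgb hq, Real.zero_rpow hb.ne', mul_zero]; exact hh_int
  set p := ⨆ x, f x
  set q := ⨆ x, g x
  set c := p ^ a * q ^ b
  have hpa : 0 < p ^ a := Real.rpow_pos_of_pos hp a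
  have hqb : 0 < q ^ b := Real.rpow_pos_of_pos hq b
  have hc : 0 < c := mul_pos hpa hqb
  have key := add_lintegral_le_of_sup_eq_one (f := fun x => f x / p) (g := fun x => g x / q)
    (h := fun x => h x / c) ha hb hab (hf.div_const _) (hg.div_const _) (hh.div_const _)
    (fun x => div_nonneg (hf0 x) hp.le) (fun x => div_nonneg (hg0 x) hq.le)
    (fun x => div_nonneg (hh0 x) hc.le)
    (fun x => (div_le_one hp).2 (le_ciSup hfb x)) (fun x => (div_le_one hq).2 (le_ciSup hgb x))
    (fun t ht => by
      obtain ⟨x, hx⟩ := exists_lt_of_lt_ciSup (show t * p < ⨆ x, f x by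
        have := mul_lt_mul_of_pos_right ht hp
        simpa using this)
      exact ⟨x, (lt_div_iff₀ hp).2 hx⟩)
    (fun t ht => by
      obtain ⟨x, hx⟩ := exists_lt_of_lt_ciSup (show t * q < ⨆ x, g x by
        have := mul_lt_mul_of_pos_right ht hq
        simpa using this)
      exact ⟨x, (lt_div_iff₀ hq).2 hx⟩)
    (fun x y => by
      rw [Real.div_rpow (hf0 x) hp.le, Real.div_rpow (hg0 y) hq.le, div_mul_div_comm]
      exact div_le_div_of_nonneg_right (H x y) hc.le)
  rw [← ofReal_integral_eq_lintegral_ofReal (hfi.div_const _)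
      (ae_of_all _ fun x => div_nonneg (hf0 x) hp.le),
    ← ofReal_integral_eq_lintegral_ofReal (hgi.div_const _)
      (ae_of_all _ fun x => div_nonneg (hg0 x) hq.le),
    ← ofReal_integral_eq_lintegral_ofReal (hhi.div_const _)
      (ae_of_all _ fun x => div_nonneg (hh0 x) hc.le),
    ← ENNReal.ofReal_mul ha.le, ← ENNReal.ofReal_mul hb.le, integral_div, integral_div,
    integral_div] at key
  have hF : 0 ≤ ∫ x, f x := integral_nonneg hf0
  have hG : 0 ≤ ∫ x, g x := integral_nonneg hg0
  rw [← ENNReal.ofReal_add (by positivity) (by positivity),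
    ENNReal.ofReal_le_ofReal_iff (by positivity)] at key
  have amgm := (Real.geom_mean_le_arith_mean2_weighted ha.le hb.le (div_nonneg hF hp.le)
    (div_nonneg hG hq.le) hab).trans key
  rwa [Real.div_rpow hF hp.le, Real.div_rpow hG hq.le, div_mul_div_comm,
    div_le_div_iff_of_pos_right hc] at amgm

/-- A measure is Prékopa–Leindler if it satisfies the Prékopa–Leindler inequality for measurable
functions with values in `[0, 1]`. -/
def IsPrekopaLeindler {E : Type*} [AddCommGroup E] [Module ℝ E] [MeasurableSpace E]
    (μ : Measure E) : Prop :=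
  ∀ a b : ℝ, 0 < a → 0 < b → a + b = 1 → ∀ f g h : E → ℝ,
    Measurable f → Measurable g → Measurable h →
    (∀ x, f x ∈ Set.Icc 0 1) → (∀ x, g x ∈ Set.Icc 0 1) → (∀ x, h x ∈ Set.Icc 0 1) →
    (∀ x y, f x ^ a * g y ^ b ≤ h (a • x + b • y)) →
    (∫ x, f x ∂μ) ^ a * (∫ x, g x ∂μ) ^ b ≤ ∫ x, h x ∂μ

theorem integrable_of_mem_Icc {E : Type*} [MeasurableSpace E] {μ : Measure E} [IsFiniteMeasure μ]
    {f : E → ℝ} (hf : Measurable f) (h : ∀ x, f x ∈ Set.Icc 0 1) : Integrable f μ :=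
  Integrable.of_bound hf.aestronglyMeasurable 1
    (ae_of_all _ fun x => by rw [Real.norm_of_nonneg (h x).1]; exact (h x).2)

theorem integral_mem_Icc {E : Type*} [MeasurableSpace E] {μ : Measure E} [IsProbabilityMeasure μ]
    {f : E → ℝ} (hf : Measurable f) (h : ∀ x, f x ∈ Set.Icc 0 1) :
    ∫ x, f x ∂μ ∈ Set.Icc 0 1 := by
  refine ⟨integral_nonneg fun x => (h x).1, ?_⟩
  calc ∫ x, f x ∂μ ≤ ∫ _, 1 ∂μ :=
        integral_mono (integrable_of_mem_Icc hf h) (integrable_const _) fun x => (h x).2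
    _ = 1 := by simp

namespace IsPrekopaLeindler

variable {E F : Type*} [AddCommGroup E] [Module ℝ E] [MeasurableSpace E]
  [AddCommGroup F] [Module ℝ F] [MeasurableSpace F]

theorem prod {μ : Measure E} {ν : Measure F} [IsProbabilityMeasure μ] [IsProbabilityMeasure ν]
    (hμ : IsPrekopaLeindler μ) (hν : IsPrekopaLeindler ν) : IsPrekopaLeindler (μ.prod ν) := by
  intro a b ha hb hab f g h hf hg hh hf1 hg1 hh1 H
  rw [integral_prod _ (integrable_of_mem_Icc hf hf1), integral_prod _ (integrable_of_mem_Icc hg hg1),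
    integral_prod _ (integrable_of_mem_Icc hh hh1)]
  have sec : ∀ {k : E × F → ℝ}, Measurable k → ∀ x, Measurable fun y => k (x, y) :=
    fun hk x => hk.comp measurable_prodMk_left
  have inner : ∀ {k : E × F → ℝ}, Measurable k → Measurable fun x => ∫ y, k (x, y) ∂ν :=
    fun {k} hk => (StronglyMeasurable.integral_prod_right (f := fun x y => k (x, y))
      hk.stronglyMeasurable).measurable
  refine hμ a b ha hb hab _ _ _ (inner hf) (inner hg) (inner hh)
    (fun x => integral_mem_Icc (sec hf x) fun y => hf1 _)
    (fun x => integral_mem_Icc (sec hg x) fun y => hg1 _)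
    (fun x => integral_mem_Icc (sec hh x) fun y => hh1 _) fun x x' => ?_
  exact hν a b ha hb hab _ _ _ (sec hf x) (sec hg x') (sec hh _) (fun y => hf1 _)
    (fun y => hg1 _) (fun y => hh1 _) fun y y' => by simpa using H (x, y) (x', y')

theorem map {μ : Measure E} (hμ : IsPrekopaLeindler μ) {L : E → F} (hL : Measurable L)
    (hlin : ∀ (a b : ℝ) x y, L (a • x + b • y) = a • L x + b • L y) :
    IsPrekopaLeindler (μ.map L) := by
  intro a b ha hb hab f g h hf hg hh hf1 hg1 hh1 H
  rw [integral_map hL.aemeasurable hf.aestronglyMeasurable,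
    integral_map hL.aemeasurable hg.aestronglyMeasurable,
    integral_map hL.aemeasurable hh.aestronglyMeasurable]
  exact hμ a b ha hb hab _ _ _ (hf.comp hL) (hg.comp hL) (hh.comp hL) (fun x => hf1 _)
    (fun x => hg1 _) (fun x => hh1 _) fun x y => by rw [hlin]; exact H _ _

theorem pi {μ : Measure ℝ} [IsProbabilityMeasure μ] (hμ : IsPrekopaLeindler μ) (n : ℕ) :
    IsPrekopaLeindler (Measure.pi fun _ : Fin n => μ) := by
  induction n with
  | zero =>
    rw [Measure.pi_of_empty _ 0]
    intro a b ha hb hab f g h hf hg hh hf1 hg1 hh1 H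
    rw [integral_dirac' _ _ hf.stronglyMeasurable, integral_dirac' _ _ hg.stronglyMeasurable,
      integral_dirac' _ _ hh.stronglyMeasurable]
    simpa using H 0 0
  | succ n ih =>
    have key := (measurePreserving_piFinSuccAbove (fun _ : Fin (n + 1) => μ) 0).symm
    rw [← key.map_eq]
    refine (hμ.prod ih).map key.measurable fun a b x y => ?_
    rw [MeasurableEquiv.piFinSuccAbove_symm_apply]
    ext i
    refine Fin.cases ?_ (fun j => ?_) i <;> simp [Fin.insertNthEquiv]

theorem measureReal_rpow_mul_le {μ : Measure E} (hμ : IsPrekopaLeindler μ) {a b : ℝ} (ha : 0 < a)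
    (hb : 0 < b) (hab : a + b = 1) {A B C : Set E} (hA : MeasurableSet A) (hB : MeasurableSet B)
    (hC : MeasurableSet C) (h : ∀ x ∈ A, ∀ y ∈ B, a • x + b • y ∈ C) :
    μ.real A ^ a * μ.real B ^ b ≤ μ.real C := by
  have ind : ∀ (S : Set E) x, S.indicator (1 : E → ℝ) x ∈ Set.Icc (0 : ℝ) 1 := fun S x => by
    by_cases hx : x ∈ S <;> simp [hx]
  have key := hμ a b ha hb hab (A.indicator 1) (B.indicator 1) (C.indicator 1)
    (measurable_one.indicator hA) (measurable_one.indicator hB) (measurable_one.indicator hC)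
    (ind A) (ind B) (ind C) fun x y => by
      by_cases hx : x ∈ A
      · by_cases hy : y ∈ B
        · simp [hx, hy, h x hx y hy]
        · simpa [hy, Real.zero_rpow hb.ne'] using (ind C _).1
      · simpa [hx, Real.zero_rpow ha.ne'] using (ind C _).1
  simpa only [integral_indicator_one hA, integral_indicator_one hB, integral_indicator_one hC]
    using key

end IsPrekopaLeindler

theorem gaussianPDFReal_rpow_mul_le {a b : ℝ} (ha : 0 < a) (hb : 0 < b) (hab : a + b = 1)
    (x y : ℝ) :
    gaussianPDFReal 0 1 x ^ a * gaussianPDFReal 0 1 y ^ b ≤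
      gaussianPDFReal 0 1 (a * x + b * y) := by
  simp only [gaussianPDFReal, sub_zero, NNReal.coe_one, mul_one]
  have hs : 0 < (√(2 * Real.pi))⁻¹ := by positivity
  set c := (√(2 * Real.pi))⁻¹
  rw [Real.mul_rpow hs.le (Real.exp_pos _).le, Real.mul_rpow hs.le (Real.exp_pos _).le,
    ← Real.exp_mul, ← Real.exp_mul, mul_mul_mul_comm, ← Real.rpow_add hs, hab, Real.rpow_one,
    ← Real.exp_add]
  gcongr
  have : b = 1 - a := by linarith
  subst this
  nlinarith [mul_nonneg (mul_pos ha hb).le (sq_nonneg (x - y))]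

theorem isPrekopaLeindler_gaussianReal : IsPrekopaLeindler (gaussianReal 0 1) := by
  intro a b ha hb hab f g h hf hg hh hf1 hg1 hh1 H
  simp only [integral_gaussianReal_eq_integral_smul one_ne_zero, smul_eq_mul]
  have hφ := measurable_gaussianPDFReal 0 1
  have hφ0 := gaussianPDFReal_nonneg 0 1
  have int : ∀ k : ℝ → ℝ, Measurable k → (∀ x, k x ∈ Set.Icc 0 1) →
      Integrable fun x => gaussianPDFReal 0 1 x * k x := fun k hk hk1 =>
    (integrable_gaussianPDFReal 0 1).mul_bdd hk.aestronglyMeasurable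
      (ae_of_all _ fun x => by rw [Real.norm_of_nonneg (hk1 x).1]; exact (hk1 x).2)
  have bdd : ∀ k : ℝ → ℝ, (∀ x, k x ∈ Set.Icc 0 1) → ∀ x,
      gaussianPDFReal 0 1 x * k x ≤ (√(2 * Real.pi))⁻¹ := fun k hk x => by
    refine (mul_le_of_le_one_right (hφ0 x) (hk x).2).trans ?_
    simp only [gaussianPDFReal, sub_zero, NNReal.coe_one, mul_one]
    refine mul_le_of_le_one_right (by positivity) (Real.exp_le_one_iff.2 ?_)
    have := sq_nonneg x
    linarith
  refine integral_rpow_mul_integral_rpow_le ha hb hab (hφ.mul hf) (hφ.mul hg) (hφ.mul hh)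
    (int f hf hf1) (int g hg hg1) (int h hh hh1) (fun x => mul_nonneg (hφ0 x) (hf1 x).1)
    (fun x => mul_nonneg (hφ0 x) (hg1 x).1) (fun x => mul_nonneg (hφ0 x) (hh1 x).1)
    (bdd f hf1) (bdd g hg1) fun x y => ?_
  rw [Real.mul_rpow (hφ0 x) (hf1 x).1, Real.mul_rpow (hφ0 y) (hg1 y).1, mul_mul_mul_comm]
  exact mul_le_mul (gaussianPDFReal_rpow_mul_le ha hb hab x y) (H x y)
    (mul_nonneg (Real.rpow_nonneg (hf1 x).1 a) (Real.rpow_nonneg (hg1 y).1 b)) (hφ0 _)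

theorem isPrekopaLeindler_stdGaussian (E : Type*) [NormedAddCommGroup E] [InnerProductSpace ℝ E]
    [FiniteDimensional ℝ E] [MeasurableSpace E] [BorelSpace E] :
    IsPrekopaLeindler (ProbabilityTheory.stdGaussian E) := by
  refine (isPrekopaLeindler_gaussianReal.pi _).map (Measurable.mono (by fun_prop) le_rfl le_rfl)
    fun a b x y => ?_
  simp only [Pi.add_apply, Pi.smul_apply, smul_eq_mul, add_smul, mul_smul,
    Finset.sum_add_distrib, Finset.smul_sum]

section Sidak

variable {E : Type*} [NormedAddCommGroup E] [InnerProductSpace ℝ E]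
    [FiniteDimensional ℝ E] [MeasurableSpace E] [BorelSpace E]

/-- Resampling the component of a standard Gaussian vector along a unit vector. -/
theorem map_resample_stdGaussian {u : E} (hu : ‖u‖ = 1) :
    ((gaussianReal 0 1).prod (ProbabilityTheory.stdGaussian E)).map
      (fun p => p.2 - ⟪p.2, u⟫ • u + p.1 • u) = ProbabilityTheory.stdGaussian E := by
  have hT : Measurable fun p : ℝ × E => p.2 - ⟪p.2, u⟫ • u + p.1 • u :=
    Continuous.measurable (by fun_prop)
  have := Measure.isProbabilityMeasure_map hT.aemeasurable
    (μ := (gaussianReal 0 1).prod (ProbabilityTheory.stdGaussian E))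
  refine Measure.ext_of_charFun ?_
  ext t
  rw [charFun_apply, integral_map hT.aemeasurable (by fun_prop)]
  have split : ∀ p : ℝ × E,
      Complex.exp ((⟪p.2 - ⟪p.2, u⟫ • u + p.1 • u, t⟫ : ℝ) * Complex.I) =
        Complex.exp ((⟪p.1, ⟪u, t⟫⟫ : ℝ) * Complex.I) *
          Complex.exp ((⟪p.2, t - ⟪u, t⟫ • u⟫ : ℝ) * Complex.I) := fun p => by
    rw [← Complex.exp_add, ← add_mul, ← Complex.ofReal_add]
    congr 3
    simp only [inner_add_left, inner_sub_left, inner_sub_right, real_inner_smul_left,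
      real_inner_smul_right, RCLike.inner_apply, conj_trivial]
    ring
  simp_rw [split]
  rw [integral_prod_mul (μ := gaussianReal 0 1) (ν := ProbabilityTheory.stdGaussian E)
    (fun s : ℝ => Complex.exp ((⟪s, ⟪u, t⟫⟫ : ℝ) * Complex.I))
    (fun y : E => Complex.exp ((⟪y, t - ⟪u, t⟫ • u⟫ : ℝ) * Complex.I)), ← charFun_apply,
    ← charFun_apply, charFun_gaussianReal, charFun_stdGaussian, charFun_stdGaussian,
    ← Complex.exp_add]
  have hn : ‖t - ⟪u, t⟫ • u‖ ^ 2 = ‖t‖ ^ 2 - ⟪u, t⟫ ^ 2 := by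
    rw [norm_sub_sq_real, norm_smul, hu, real_inner_smul_right, real_inner_comm, mul_one,
      Real.norm_eq_abs, sq_abs, real_inner_comm]
    ring
  rw [← Complex.ofReal_pow ‖t - _‖, hn]
  congr 1
  push_cast
  simp
  ring

theorem measureReal_neg_stdGaussian {A : Set E} (hA : MeasurableSet A) :
    (ProbabilityTheory.stdGaussian E).real {y | -y ∈ A} =
      (ProbabilityTheory.stdGaussian E).real A := by
  conv_rhs => rw [← stdGaussian_map (LinearIsometryEquiv.neg ℝ (E := E)),
    map_measureReal_apply (LinearIsometryEquiv.neg ℝ (E := E)).continuous.measurable hA]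
  rfl

/-- The Gaussian measure of the sections of a symmetric convex set orthogonal to a vector `u`
decreases as the section moves away from the origin. -/
theorem measureReal_section_anti {K : Set E} (hK : MeasurableSet K) (hconv : Convex ℝ K)
    (hsymm : ∀ y ∈ K, -y ∈ K) (u : E) {s t : ℝ} (hst : |s| ≤ |t|) :
    (ProbabilityTheory.stdGaussian E).real {y | y - ⟪y, u⟫ • u + t • u ∈ K} ≤
      (ProbabilityTheory.stdGaussian E).real {y | y - ⟪y, u⟫ • u + s • u ∈ K} := by
  have meas : ∀ r : ℝ, MeasurableSet {y : E | y - ⟪y, u⟫ • u + r • u ∈ K} := fun r => by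
    have : Measurable fun y : E => y - ⟪y, u⟫ • u + r • u := Continuous.measurable (by fun_prop)
    exact this hK
  have even : ∀ r : ℝ, (ProbabilityTheory.stdGaussian E).real {y | y - ⟪y, u⟫ • u + (-r) • u ∈ K} =
      (ProbabilityTheory.stdGaussian E).real {y | y - ⟪y, u⟫ • u + r • u ∈ K} := fun r => by
    rw [← measureReal_neg_stdGaussian (meas r)]
    congr 1
    ext y
    have e : -y - ⟪-y, u⟫ • u + r • u = -(y - ⟪y, u⟫ • u + (-r) • u) := by
      rw [inner_neg_left]
      module
    simp only [Set.mem_ofPred_eq, e]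
    exact ⟨fun h => hsymm _ h, fun h => by simpa using hsymm _ h⟩
  rcases hst.eq_or_lt with h | h
  · rcases abs_eq_abs.1 h with rfl | rfl
    · exact le_rfl
    · exact (even t).ge
  have ht : 0 < |t| := (abs_nonneg s).trans_lt h
  have ht0 : t ≠ 0 := abs_pos.1 ht
  have hr : |s / t| < 1 := by rwa [abs_div, div_lt_one ht]
  obtain ⟨hr1, hr2⟩ := abs_lt.1 hr
  obtain ⟨a, b, ha, hb, hab, hs⟩ : ∃ a b : ℝ, 0 < a ∧ 0 < b ∧ a + b = 1 ∧ s = a * t + b * (-t) :=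
    ⟨(1 + s / t) / 2, (1 - s / t) / 2, by linarith, by linarith, by ring, by field_simp; ring⟩
  have key := (isPrekopaLeindler_stdGaussian E).measureReal_rpow_mul_le ha hb hab (meas t)
    (meas (-t)) (meas s) fun x hx y hy => by
      have := hconv hx hy ha.le hb.le hab
      simp only [Set.mem_ofPred_eq]
      convert this using 1
      rw [inner_add_left, real_inner_smul_left, real_inner_smul_left, hs]
      module
  rw [even t] at key
  set r := (ProbabilityTheory.stdGaussian E).real {y | y - ⟪y, u⟫ • u + t • u ∈ K}
  have hr0 : 0 ≤ r := measureReal_nonneg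
  rwa [← Real.rpow_add_of_nonneg hr0 ha.le hb.le, hab, Real.rpow_one] at key

/-- **Šidák's inequality**: a symmetric convex set and a symmetric slab are positively correlated
under the standard Gaussian measure. -/
theorem mul_gaussianReal_le_stdGaussian_inter {K : Set E} (hK : MeasurableSet K)
    (hconv : Convex ℝ K) (hsymm : ∀ y ∈ K, -y ∈ K) {u : E} (hu : ‖u‖ = 1) {ρ : ℝ} (hρ : 0 < ρ) :
    gaussianReal 0 1 {s | |s| ≤ ρ} * ProbabilityTheory.stdGaussian E K ≤
      ProbabilityTheory.stdGaussian E (K ∩ {y | |⟪y, u⟫| ≤ ρ}) := by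
  have hT : Measurable fun p : ℝ × E => p.2 - ⟪p.2, u⟫ • u + p.1 • u :=
    Continuous.measurable (by fun_prop)
  have hI : MeasurableSet {s : ℝ | |s| ≤ ρ} :=
    measurableSet_le (Continuous.measurable (by fun_prop)) measurable_const
  have hS : MeasurableSet {y : E | |⟪y, u⟫| ≤ ρ} :=
    measurableSet_le (Continuous.measurable (by fun_prop)) measurable_const
  have hG := (map_resample_stdGaussian hu).symm
  set G := ProbabilityTheory.stdGaussian E
  set γ := gaussianReal 0 1
  set I := {s : ℝ | |s| ≤ ρ}
  set h : ℝ → ENNReal := fun s => G {y | y - ⟪y, u⟫ • u + s • u ∈ K}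
  have anti : ∀ s t : ℝ, |s| ≤ |t| → h t ≤ h s := fun s t hst =>
    (ENNReal.toReal_le_toReal (measure_ne_top _ _) (measure_ne_top _ _)).1
      (measureReal_section_anti hK hconv hsymm u hst)
  have total : G K = ∫⁻ s, h s ∂γ := by
    conv_lhs => rw [hG, Measure.map_apply hT hK,
      Measure.prod_apply (hT hK)]
    rfl
  have slab : G (K ∩ {y | |⟪y, u⟫| ≤ ρ}) = ∫⁻ s in I, h s ∂γ := by
    conv_lhs => rw [hG, Measure.map_apply hT (hK.inter hS),
      Measure.prod_apply (hT (hK.inter hS))]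
    rw [← lintegral_indicator hI]
    refine lintegral_congr fun s => ?_
    have coord : ∀ y : E, ⟪y - ⟪y, u⟫ • u + s • u, u⟫ = s := fun y => by
      rw [inner_add_left, inner_sub_left, real_inner_smul_left, real_inner_smul_left,
        real_inner_self_eq_norm_sq, hu]
      ring
    by_cases hs : s ∈ I
    · rw [Set.indicator_of_mem hs]
      congr 1
      ext y
      have hs' : |s| ≤ ρ := hs
      simp [coord, hs']
    · rw [Set.indicator_of_notMem hs, ← measure_empty (μ := G)]
      congr 1
      ext y
      have hs' : ¬ |s| ≤ ρ := hs
      simp [coord, hs']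
  have lower : h ρ * γ I ≤ ∫⁻ s in I, h s ∂γ := by
    rw [← setLIntegral_const]
    exact setLIntegral_mono' hI fun s hs => anti s ρ (hs.trans (le_abs_self ρ))
  have upper : ∫⁻ s in Iᶜ, h s ∂γ ≤ h ρ * γ Iᶜ := by
    rw [← setLIntegral_const]
    refine setLIntegral_mono' hI.compl fun s hs => anti ρ s ?_
    rw [abs_of_pos hρ]
    have hs' : ¬ |s| ≤ ρ := hs
    exact (not_le.1 hs').le
  rw [slab, total, ← lintegral_add_compl h hI, mul_add]
  calc γ I * ∫⁻ s in I, h s ∂γ + γ I * ∫⁻ s in Iᶜ, h s ∂γ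
      ≤ γ I * (∫⁻ s in I, h s ∂γ) + γ I * (h ρ * γ Iᶜ) := by gcongr
    _ = γ I * (∫⁻ s in I, h s ∂γ) + (h ρ * γ I) * γ Iᶜ := by ring
    _ ≤ γ I * (∫⁻ s in I, h s ∂γ) + (∫⁻ s in I, h s ∂γ) * γ Iᶜ := by gcongr
    _ = (∫⁻ s in I, h s ∂γ) * (γ I + γ Iᶜ) := by ring
    _ = ∫⁻ s in I, h s ∂γ := by rw [measure_add_measure_compl hI, measure_univ, mul_one]

theorem gaussianReal_pow_card_le_stdGaussian_slabs {ι : Type*} (I : Finset ι) {u : ι → E}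
    (hu : ∀ i, ‖u i‖ ≤ 1) {ρ : ℝ} (hρ : 0 < ρ) :
    gaussianReal 0 1 {s | |s| ≤ ρ} ^ I.card ≤
      ProbabilityTheory.stdGaussian E {y | ∀ i ∈ I, |⟪y, u i⟫| ≤ ρ} := by
  classical
  induction I using Finset.induction_on with
  | empty => simp
  | insert i I hi ih =>
    rw [Finset.card_insert_of_notMem hi, pow_succ']
    set K := {y : E | ∀ i ∈ I, |⟪y, u i⟫| ≤ ρ}
    have hKi : K = ⋂ i ∈ I, {y : E | |⟪y, u i⟫| ≤ ρ} := by ext; simp [K]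
    have hK : MeasurableSet K := by
      rw [hKi]
      exact Finset.measurableSet_biInter _ fun i _ =>
        measurableSet_le (Continuous.measurable (by fun_prop)) measurable_const
    have hconv : Convex ℝ K := by
      intro x hx y hy a b ha hb hab j hj
      rw [inner_add_left, real_inner_smul_left, real_inner_smul_left]
      calc |a * ⟪x, u j⟫ + b * ⟪y, u j⟫| ≤ a * |⟪x, u j⟫| + b * |⟪y, u j⟫| := by
            refine (abs_add_le _ _).trans_eq ?_
            rw [abs_mul, abs_mul, abs_of_nonneg ha, abs_of_nonneg hb]
        _ ≤ a * ρ + b * ρ := by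
            have := hx j hj
            have := hy j hj
            gcongr
        _ = ρ := by rw [← add_mul, hab, one_mul]
    have hsymm : ∀ y ∈ K, -y ∈ K := fun y hy j hj => by
      rw [inner_neg_left, abs_neg]
      exact hy j hj
    refine (mul_le_mul_right ih _).trans ?_
    by_cases h0 : u i = 0
    · refine (mul_le_of_le_one_left' prob_le_one).trans (measure_mono fun y hy j hj => ?_)
      rcases Finset.mem_insert.1 hj with rfl | hj
      · simp [h0, hρ.le]
      · exact hy j hj
    · refine (mul_gaussianReal_le_stdGaussian_inter hK hconv hsymm
        (norm_smul_inv_norm (𝕜 := ℝ) h0) hρ).trans (measure_mono fun y hy j hj => ?_)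
      rcases Finset.mem_insert.1 hj with rfl | hj
      · have hy2 : |⟪y, ((‖u j‖⁻¹ : ℝ)) • u j⟫| ≤ ρ := hy.2
        have hpos : 0 < ‖u j‖ := norm_pos_iff.2 h0
        rw [real_inner_smul_right, abs_mul, abs_of_pos (inv_pos.2 hpos),
          inv_mul_le_iff₀ hpos] at hy2
        exact hy2.trans (mul_le_of_le_one_left hρ.le (hu j))
      · exact hy.1 j hj

end Sidak

theorem one_sub_exp_le_gaussianReal {ρ : ℝ} (hρ : 0 < ρ) :
    ENNReal.ofReal (1 - Real.exp (-(ρ ^ 2) / 2)) ≤ gaussianReal 0 1 {s | |s| ≤ ρ} := by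
  set γ := gaussianReal 0 1
  have real_eq : ∀ s : Set ℝ, γ.real s = ∫ x in s, gaussianPDFReal 0 1 x := fun s => by
    rw [measureReal_def, gaussianReal_apply_eq_integral 0 one_ne_zero,
      ENNReal.toReal_ofReal (integral_nonneg (gaussianPDFReal_nonneg 0 1))]
  have neg : ∀ r : ℝ, γ.real (Set.Iio (-r)) = γ.real (Set.Ioi r) := fun r => by
    have : γ.map (fun x => -x) = γ := by simp [γ, gaussianReal_map_neg]
    conv_rhs => rw [← this, map_measureReal_apply measurable_neg measurableSet_Ioi]
    congr 1
    ext x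
    simp
  have half : 2 * γ.real (Set.Ioi 0) ≤ 1 := by
    have h := measureReal_union (μ := γ) (s₁ := Set.Iio 0) (s₂ := Set.Ioi 0)
      (Set.disjoint_left.2 fun x hx hx' => lt_asymm (Set.mem_Iio.1 hx) (Set.mem_Ioi.1 hx')) measurableSet_Ioi
    have h0 := neg 0
    rw [neg_zero] at h0
    have := measureReal_le_one (μ := γ) (s := Set.Iio 0 ∪ Set.Ioi 0)
    linarith
  have tail : γ.real (Set.Ioi ρ) ≤ Real.exp (-(ρ ^ 2) / 2) * γ.real (Set.Ioi 0) := by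
    rw [real_eq, real_eq, ← integral_const_mul,
      ← (measurePreserving_add_right volume ρ).setIntegral_preimage_emb
        (measurableEmbedding_addRight ρ)]
    have hpre : (fun x => x + ρ) ⁻¹' Set.Ioi ρ = Set.Ioi 0 := by ext x; simp
    rw [hpre]
    refine setIntegral_mono_on ?_ ((integrable_gaussianPDFReal 0 1).const_mul _).integrableOn
      measurableSet_Ioi fun x hx => ?_
    · exact ((integrable_gaussianPDFReal 0 1).comp_add_right ρ).integrableOn
    · simp only [gaussianPDFReal, sub_zero, NNReal.coe_one, mul_one]
      rw [mul_left_comm, ← Real.exp_add]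
      have hx' : 0 < x := hx
      gcongr
      nlinarith [mul_pos hx' hρ]
  have hI : MeasurableSet {s : ℝ | |s| ≤ ρ} :=
    measurableSet_le (Continuous.measurable (by fun_prop)) measurable_const
  have compl : γ.real {s : ℝ | |s| ≤ ρ}ᶜ ≤ Real.exp (-(ρ ^ 2) / 2) := by
    have sub : {s : ℝ | |s| ≤ ρ}ᶜ ⊆ Set.Iio (-ρ) ∪ Set.Ioi ρ := fun s hs => by
      have : ρ < |s| := not_le.1 hs
      rcases lt_abs.1 this with h | h
      · exact Or.inr h
      · exact Or.inl (lt_neg.1 h)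
    have := (measureReal_mono (μ := γ) sub).trans (measureReal_union_le _ _)
    rw [neg] at this
    have := Real.exp_pos (-(ρ ^ 2) / 2)
    nlinarith
  rw [probReal_compl_eq_one_sub hI] at compl
  rw [← ofReal_measureReal]
  exact ENNReal.ofReal_le_ofReal (by linarith)

theorem integrable_exp_neg_mul_sq_norm {E : Type*} [NormedAddCommGroup E] [InnerProductSpace ℝ E]
    [FiniteDimensional ℝ E] [MeasurableSpace E] [BorelSpace E] {b : ℝ} (hb : 0 < b) :
    Integrable fun v : E => Real.exp (-b * ‖v‖ ^ 2) := by
  have := (GaussianFourier.integrable_cexp_neg_mul_sq_norm_add (b := (b : ℂ)) (V := E) (by simpa)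
    0 0).norm
  refine this.congr (ae_of_all _ fun v => ?_)
  simp only [Complex.norm_exp]
  norm_cast
  simp

theorem integral_stdGaussian {F : Type*} [NormedAddCommGroup F] [NormedSpace ℝ F] (n : ℕ)
    (g : EuclideanSpace ℝ (Fin n) → F) :
    ∫ x, g x ∂(stdGaussian n) =
      ∫ x, ((2 * Real.pi) ^ (-(n : ℝ) / 2) * Real.exp (-‖x‖ ^ 2 / 2)) • g x := by
  rw [stdGaussian, integral_withDensity_eq_integral_toReal_smul
    (Continuous.measurable (by fun_prop)).ennreal_ofReal (ae_of_all _ fun x => ENNReal.ofReal_lt_top)]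
  congr 1
  ext x
  rw [ENNReal.toReal_ofReal (by positivity)]

instance isFiniteMeasure_stdGaussian (n : ℕ) : IsFiniteMeasure (stdGaussian n) := by
  refine isFiniteMeasure_withDensity_ofReal (Integrable.hasFiniteIntegral ?_)
  refine Integrable.const_mul ?_ _
  refine (integrable_exp_neg_mul_sq_norm one_half_pos).congr (ae_of_all _ fun x => ?_)
  change Real.exp _ = Real.exp _
  congr 1
  ring

theorem stdGaussian_eq (n : ℕ) :
    stdGaussian n = ProbabilityTheory.stdGaussian (EuclideanSpace ℝ (Fin n)) := by
  refine Measure.ext_of_charFun ?_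
  ext t
  rw [charFun_apply, charFun_stdGaussian, integral_stdGaussian]
  have e : ∀ x : EuclideanSpace ℝ (Fin n),
      ((2 * Real.pi) ^ (-(n : ℝ) / 2) * Real.exp (-‖x‖ ^ 2 / 2)) •
        Complex.exp ((⟪x, t⟫ : ℝ) * Complex.I) =
      (((2 * Real.pi) ^ (-(n : ℝ) / 2) : ℝ) : ℂ) *
        Complex.exp (-((1 / 2 : ℝ) : ℂ) * ‖x‖ ^ 2 + Complex.I * (⟪t, x⟫ : ℝ)) := fun x => by
    rw [Complex.exp_add, Complex.real_smul, real_inner_comm]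
    push_cast
    rw [mul_assoc, mul_comm Complex.I]
    congr 3
    ring
  simp_rw [e]
  rw [integral_const_mul, GaussianFourier.integral_cexp_neg_mul_sq_norm_add (by simp),
    finrank_euclideanSpace_fin, ← mul_assoc]
  have c1 : (((2 * Real.pi) ^ (-(n : ℝ) / 2) : ℝ) : ℂ) *
      ((Real.pi : ℂ) / ((1 / 2 : ℝ) : ℂ)) ^ ((n : ℂ) / 2) = 1 := by
    have : ((Real.pi : ℂ) / ((1 / 2 : ℝ) : ℂ)) ^ ((n : ℂ) / 2) =
        (((2 * Real.pi) ^ ((n : ℝ) / 2) : ℝ) : ℂ) := by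
      rw [Complex.ofReal_cpow (by positivity)]
      push_cast
      congr 1
      ring
    rw [this, ← Complex.ofReal_mul, ← Real.rpow_add (by positivity)]
    simp [neg_div]
  rw [c1, one_mul, Complex.I_sq]
  congr 1
  push_cast
  ring

theorem log_one_sub_le {ε : ℝ} (h0 : 0 < ε) (h1 : ε < 1) : Real.log (1 - ε) ≤ -ε - ε ^ 2 / 2 := by
  have h := sum_le_hasSum (Finset.range 2) (fun i _ => by positivity)
    (Real.hasSum_pow_div_log_of_abs_lt_one (by rwa [abs_of_pos h0]))
  simp only [Finset.sum_range_succ, Finset.sum_range_zero] at h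
  norm_num at h
  linarith

theorem stdGaussian_norm_sq_le {ε : ℝ} (h0 : 0 < ε) (h1 : ε < 1) (n : ℕ) :
    (stdGaussian n).real {y | ‖y‖ ^ 2 ≤ (1 - ε) * n} ≤ Real.exp (-(ε ^ 2 / 4) * n) := by
  have hd : 0 < 1 - ε := by linarith
  set t : ℝ := -(ε / (2 * (1 - ε))) with ht
  have ht0 : t ≤ 0 := by rw [ht]; exact neg_nonpos.2 (by positivity)
  have int : Integrable (fun y : EuclideanSpace ℝ (Fin n) => Real.exp (t * ‖y‖ ^ 2))
      (stdGaussian n) := by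
    refine Integrable.of_bound (Continuous.aestronglyMeasurable (by fun_prop)) 1
      (ae_of_all _ fun x => ?_)
    rw [Real.norm_of_nonneg (Real.exp_pos _).le]
    exact Real.exp_le_one_iff.2 (mul_nonpos_of_nonpos_of_nonneg ht0 (sq_nonneg _))
  have hmgf : mgf (fun y : EuclideanSpace ℝ (Fin n) => ‖y‖ ^ 2) (stdGaussian n) t =
      Real.exp (Real.log (1 - ε) * (n / 2)) := by
    have e : ∀ x : EuclideanSpace ℝ (Fin n),
        ((2 * Real.pi) ^ (-(n : ℝ) / 2) * Real.exp (-‖x‖ ^ 2 / 2)) • Real.exp (t * ‖x‖ ^ 2) =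
        (2 * Real.pi) ^ (-(n : ℝ) / 2) * Real.exp (-(1 / (2 * (1 - ε))) * ‖x‖ ^ 2) := fun x => by
      rw [smul_eq_mul, mul_assoc, ← Real.exp_add]
      congr 2
      rw [ht]
      field_simp
      ring
    rw [mgf, integral_stdGaussian]
    simp_rw [e]
    rw [integral_const_mul, GaussianFourier.integral_rexp_neg_mul_sq_norm (by positivity),
      finrank_euclideanSpace_fin]
    have : Real.pi / (1 / (2 * (1 - ε))) = (2 * Real.pi) * (1 - ε) := by field_simp
    rw [this, Real.mul_rpow (by positivity) hd.le, ← mul_assoc, ← Real.rpow_add (by positivity),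
      neg_div, neg_add_cancel, Real.rpow_zero, one_mul, Real.rpow_def_of_pos hd]
  have h := measure_le_le_exp_mul_mgf ((1 - ε) * n) ht0 int
  rw [hmgf, ← Real.exp_add] at h
  refine h.trans (Real.exp_le_exp.2 ?_)
  have hlog := log_one_sub_le h0 h1
  have e1 : -t * ((1 - ε) * n) = ε * (n / 2) := by rw [ht]; field_simp
  have hn : (0 : ℝ) ≤ n / 2 := by positivity
  rw [e1]
  nlinarith [mul_le_mul_of_nonneg_right hlog hn]

/-- Estimate (2.2.3): if `α ≥ 1`, `0 < ε < 1` and `ρ > 0` satisfies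
`α ln(1 - e^{-ρ²/2}) > -ε²/4`, then for all sufficiently large `n` and all `u₁, …, u_m` with
`‖uᵢ‖ ≤ 1` and `m ≤ αn`, the Gaussian measure of
`{y ∈ Q : ‖y‖² ≥ (1 - ε)n}`, where `Q = {y : |⟨y, uᵢ⟩| ≤ ρ}`,
is at least `(1/2)(1 - e^{-ρ²/2})^{αn}`. -/
theorem stmt_10 (α ε ρ : ℝ) (hα : 1 ≤ α) (hε0 : 0 < ε) (hε1 : ε < 1) (hρ : 0 < ρ)
    (h1 : -(ε ^ 2 / 4) < α * Real.log (1 - Real.exp (-(ρ ^ 2) / 2))) :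
    ∃ N : ℕ, ∀ n : ℕ, N ≤ n →
      ∀ (m : ℕ) (u : Fin m → EuclideanSpace ℝ (Fin n)),
        (∀ i, ‖u i‖ ≤ 1) → (m : ℝ) ≤ α * n →
        ENNReal.ofReal (1 / 2 * (1 - Real.exp (-(ρ ^ 2) / 2)) ^ (α * n)) ≤
          stdGaussian n
            {y : EuclideanSpace ℝ (Fin n) |
              (∀ i, |⟪y, u i⟫| ≤ ρ) ∧ (1 - ε) * n ≤ ‖y‖ ^ 2} := by
  have hc1 : 1 - Real.exp (-(ρ ^ 2) / 2) ≤ 1 := by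
    have := Real.exp_pos (-(ρ ^ 2) / 2)
    linarith
  have hc0 : 0 < 1 - Real.exp (-(ρ ^ 2) / 2) := by
    have : Real.exp (-(ρ ^ 2) / 2) < 1 := by
      rw [← Real.exp_zero]
      exact Real.exp_lt_exp.2 (by nlinarith)
    linarith
  have hp := one_sub_exp_le_gaussianReal hρ
  set c := 1 - Real.exp (-(ρ ^ 2) / 2)
  set δ := α * Real.log c + ε ^ 2 / 4
  have hδ : 0 < δ := by simp only [δ]; linarith
  refine ⟨⌈Real.log 2 / δ⌉₊, fun n hn m u hu hm => ?_⟩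
  set S := {y : EuclideanSpace ℝ (Fin n) | (∀ i, |⟪y, u i⟫| ≤ ρ) ∧ (1 - ε) * n ≤ ‖y‖ ^ 2}
  have hnδ : Real.log 2 ≤ n * δ := (div_le_iff₀ hδ).1 (Nat.ceil_le.1 hn)
  have hQ : c ^ (α * n) ≤ (stdGaussian n).real {y | ∀ i ∈ Finset.univ, |⟪y, u i⟫| ≤ ρ} := by
    have hQ' := (pow_le_pow_left' hp _).trans
      (gaussianReal_pow_card_le_stdGaussian_slabs Finset.univ hu hρ)
    rw [← stdGaussian_eq, Finset.card_univ, Fintype.card_fin, ← ENNReal.ofReal_pow hc0.le] at hQ'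
    refine le_trans ?_ ((ENNReal.ofReal_le_iff_le_toReal (measure_ne_top _ _)).1 hQ')
    rw [← Real.rpow_natCast]
    exact Real.rpow_le_rpow_of_exponent_ge hc0 hc1 hm
  have htail : (stdGaussian n).real {y | ‖y‖ ^ 2 ≤ (1 - ε) * n} ≤ 1 / 2 * c ^ (α * n) := by
    refine (stdGaussian_norm_sq_le hε0 hε1 n).trans ?_
    have half : (1 / 2 : ℝ) = Real.exp (-Real.log 2) := by
      rw [Real.exp_neg, Real.exp_log two_pos, one_div]
    rw [half, Real.rpow_def_of_pos hc0, ← Real.exp_add]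
    refine Real.exp_le_exp.2 ?_
    simp only [δ] at hnδ
    linarith
  have hsub : {y | ∀ i ∈ Finset.univ, |⟪y, u i⟫| ≤ ρ} ⊆ S ∪ {y | ‖y‖ ^ 2 ≤ (1 - ε) * n} := by
    intro y hy
    rcases le_total ((1 - ε) * n) (‖y‖ ^ 2) with h | h
    · exact Or.inl ⟨fun i => hy i (Finset.mem_univ i), h⟩
    · exact Or.inr h
  have hunion := (measureReal_mono (μ := stdGaussian n) hsub).trans (measureReal_union_le _ _)
  rw [← ofReal_measureReal]
  exact ENNReal.ofReal_le_ofReal (by linarith)
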